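/- Let A = [[I_r, 0],[0, A₁]] and B = [[C, 0],[0, B₁]] be block-diagonal matrices in M_n(ℝ₊), where A₁, B₁ ∈ M_{n−r}(ℝ₊) and C = (c_{ij}) ∈ M_r(ℝ₊). If c_{ii} = 0 for some 1 ≤ i ≤ r and ‖A₁⊗B₁‖ = ‖B₁⊗A₁‖, then W_max(A⊗B) = W_max(B⊗A) = [0, max(‖A₁⊗B₁‖, ‖C‖)]. -/

import Mathlib

open Matrix

namespace MaxAlg

variable {I J K : Type*}

/-- Entrywise nonnegative matrix (matrix over `ℝ₊`). -/
def Nonneg (A : Matrix I J ℝ) : Prop := ∀ i j, 0 ≤ A i j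

/-- Max-algebra matrix product: `(A ⊗ B) i k = max_j (A i j * B j k)`. -/
noncomputable def maxMul [Fintype J] (A : Matrix I J ℝ) (B : Matrix J K ℝ) :
    Matrix I K ℝ :=
  Matrix.of fun i k => ⨆ j, A i j * B j k

/-- Max trace: `tr_⊗(M) = max_i M i i`. -/
noncomputable def maxTrace (M : Matrix I I ℝ) : ℝ := ⨆ i, M i i

/-- Max isometry: a nonnegative matrix `X` with `Xᵗ ⊗ X = I`. -/
def IsMaxIsometry [Fintype I] [Fintype J] [DecidableEq J] (X : Matrix I J ℝ) : Prop :=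
  Nonneg X ∧ maxMul Xᵀ X = 1

/-- Max numerical range `W_max(A) = {xᵗ⊗A⊗x : x ∈ ℝ₊ⁿ, xᵗ⊗x = 1}`,
vectors being treated as `n × 1` matrices. -/
noncomputable def WMax [Fintype I] (A : Matrix I I ℝ) : Set ℝ :=
  {r | ∃ x : Matrix I (Fin 1) ℝ, Nonneg x ∧ maxMul xᵀ x = 1 ∧
    r = maxMul xᵀ (maxMul A x) 0 0}

/-- Max rank-`k` numerical range
`Λ_k^max(A) = {λ ∈ ℝ₊ : Xᵗ⊗A⊗X = λ I_k for some max isometry X}`. -/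
noncomputable def LambdaMax [Fintype I] (k : ℕ) (A : Matrix I I ℝ) : Set ℝ :=
  {lam | 0 ≤ lam ∧ ∃ X : Matrix I (Fin k) ℝ, IsMaxIsometry X ∧
    maxMul Xᵀ (maxMul A X) = lam • (1 : Matrix (Fin k) (Fin k) ℝ)}

/-- Max `k`-numerical range `W_max^k(A) = {tr_⊗(Xᵗ⊗A⊗X) : X ∈ 𝒳_{n×k}}`. -/
noncomputable def WMaxK [Fintype I] (k : ℕ) (A : Matrix I I ℝ) : Set ℝ :=
  {r | ∃ X : Matrix I (Fin k) ℝ, IsMaxIsometry X ∧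
    r = maxTrace (maxMul Xᵀ (maxMul A X))}

/-- Max joint `k`-numerical range of an `m`-tuple of matrices. -/
noncomputable def WMaxKJoint [Fintype I] {m : ℕ} (k : ℕ)
    (A : Fin m → Matrix I I ℝ) : Set (Fin m → ℝ) :=
  {v | ∃ X : Matrix I (Fin k) ℝ, IsMaxIsometry X ∧
    ∀ l, v l = maxTrace (maxMul Xᵀ (maxMul (A l) X))}

/-- Sup-norm of a real matrix: maximum absolute value of an entry. -/
noncomputable def matNorm (M : Matrix I J ℝ) : ℝ := ⨆ i, ⨆ j, |M i j|

/-- Sup-norm of a real vector: maximum absolute value of an entry. -/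
noncomputable def vecNorm (v : I → ℝ) : ℝ := ⨆ i, |v i|

/-- Entrywise maximum (`max sum`) of two matrices. -/
def maxAdd (A B : Matrix I J ℝ) : Matrix I J ℝ :=
  Matrix.of fun i j => max (A i j) (B i j)

/-- Max joint `c`-numerical range of an `m`-tuple of matrices:
`{(max_i c_i (xᵢᵗ⊗A₁⊗xᵢ), …) : X = [x₁,…,xₙ] max unitary}`; note that
`xᵢᵗ⊗A⊗xᵢ` is the `(i,i)` entry of `Xᵗ⊗A⊗X`. -/
noncomputable def WMaxCJoint {n m : ℕ} (c : Fin n → ℝ)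
    (A : Fin m → Matrix (Fin n) (Fin n) ℝ) : Set (Fin m → ℝ) :=
  {v | ∃ U : Matrix (Fin n) (Fin n) ℝ, IsMaxIsometry U ∧
    ∀ l, v l = ⨆ i, c i * maxMul Uᵀ (maxMul (A l) U) i i}

/-- Max joint `C`-numerical range of an `m`-tuple of matrices:
`{(tr_⊗(C⊗Xᵗ⊗A₁⊗X), …) : X max unitary}`. -/
noncomputable def WMaxBigCJoint {n m : ℕ} (C : Matrix (Fin n) (Fin n) ℝ)
    (A : Fin m → Matrix (Fin n) (Fin n) ℝ) : Set (Fin m → ℝ) :=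
  {v | ∃ X : Matrix (Fin n) (Fin n) ℝ, IsMaxIsometry X ∧
    ∀ l, v l = maxTrace (maxMul C (maxMul Xᵀ (maxMul (A l) X)))}

lemma le_iSup_of_finite {ι : Type*} [Finite ι] (f : ι → ℝ) (i : ι) : f i ≤ ⨆ j, f j :=
  le_ciSup (Set.finite_range f).bddAbove i

lemma continuous_iSup_of_finite {ι X : Type*} [Fintype ι] [Nonempty ι] [TopologicalSpace X]
    {f : ι → X → ℝ} (hf : ∀ i, Continuous (f i)) : Continuous fun t => ⨆ i, f i t := by
  simp only [← Finset.sup'_univ_eq_ciSup]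
  exact Continuous.finset_sup'_apply _ fun i _ => hf i

lemma Nonneg.maxMul [Fintype J] {A : Matrix I J ℝ} {B : Matrix J K ℝ}
    (hA : Nonneg A) (hB : Nonneg B) : Nonneg (maxMul A B) := fun i k =>
  Real.iSup_nonneg fun j => mul_nonneg (hA i j) (hB j k)

lemma Nonneg.fromBlocks {I' J' : Type*} {P : Matrix I J ℝ} {Q : Matrix I' J' ℝ}
    (hP : Nonneg P) (hQ : Nonneg Q) : Nonneg (Matrix.fromBlocks P 0 0 Q) := by
  rintro (i | i) (j | j)
  · exact hP i j
  · exact le_rfl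
  · exact le_rfl
  · exact hQ i j

lemma nonneg_one [DecidableEq I] : Nonneg (1 : Matrix I I ℝ) := fun i j => by
  rw [Matrix.one_apply]; split_ifs <;> norm_num

lemma matNorm_nonneg (M : Matrix I J ℝ) : 0 ≤ matNorm M :=
  Real.iSup_nonneg fun _ => Real.iSup_nonneg fun _ => abs_nonneg _

lemma abs_le_matNorm [Finite I] [Finite J] (M : Matrix I J ℝ) (i : I) (j : J) :
    |M i j| ≤ matNorm M :=
  (le_iSup_of_finite (fun j => |M i j|) j).trans
    (le_iSup_of_finite (fun i => ⨆ j, |M i j|) i)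

lemma matNorm_le {M : Matrix I J ℝ} {a : ℝ} (ha : 0 ≤ a) (h : ∀ i j, |M i j| ≤ a) :
    matNorm M ≤ a :=
  Real.iSup_le (fun i => Real.iSup_le (h i) ha) ha

/-- The norm of a block-diagonal matrix is the maximum of the norms of its blocks. -/
lemma matNorm_fromBlocks {I' J' : Type*} [Finite I] [Finite J] [Finite I'] [Finite J']
    (P : Matrix I J ℝ) (Q : Matrix I' J' ℝ) :
    matNorm (Matrix.fromBlocks P 0 0 Q) = max (matNorm P) (matNorm Q) := by
  have h0 : 0 ≤ max (matNorm P) (matNorm Q) := le_max_of_le_left (matNorm_nonneg P)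
  apply le_antisymm
  · refine matNorm_le h0 ?_
    rintro (i | i) (j | j)
    · exact le_max_of_le_left (abs_le_matNorm P i j)
    · simpa using h0
    · simpa using h0
    · exact le_max_of_le_right (abs_le_matNorm Q i j)
  · refine max_le (matNorm_le (matNorm_nonneg _) fun i j => ?_)
      (matNorm_le (matNorm_nonneg _) fun i j => ?_)
    · exact abs_le_matNorm (Matrix.fromBlocks P 0 0 Q) (Sum.inl i) (Sum.inl j)
    · exact abs_le_matNorm (Matrix.fromBlocks P 0 0 Q) (Sum.inr i) (Sum.inr j)

lemma one_maxMul [Fintype I] [DecidableEq I] {A : Matrix I K ℝ} (hA : Nonneg A) :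
    maxMul 1 A = A := by
  ext i k
  apply le_antisymm
  · refine Real.iSup_le (fun j => ?_) (hA i k)
    by_cases h : i = j
    · subst h; simp
    · simpa [Matrix.one_apply_ne h] using hA i k
  · simpa [maxMul] using le_iSup_of_finite (fun j => (1 : Matrix I I ℝ) i j * A j k) i

lemma maxMul_one [Fintype J] [DecidableEq J] {A : Matrix I J ℝ} (hA : Nonneg A) :
    maxMul A 1 = A := by
  ext i k
  apply le_antisymm
  · refine Real.iSup_le (fun j => ?_) (hA i k)
    by_cases h : j = k
    · subst h; simp
    · simpa [Matrix.one_apply_ne h] using hA i k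
  · simpa [maxMul] using le_iSup_of_finite (fun j => A i j * (1 : Matrix J J ℝ) j k) k

/-- The max product of block-diagonal nonnegative matrices is taken blockwise. -/
lemma maxMul_fromBlocks {I' J' K' : Type*} [Fintype J] [Fintype J']
    {P : Matrix I J ℝ} {Q : Matrix I' J' ℝ} {R : Matrix J K ℝ} {S : Matrix J' K' ℝ}
    (hP : Nonneg P) (hQ : Nonneg Q) (hR : Nonneg R) (hS : Nonneg S) :
    maxMul (Matrix.fromBlocks P 0 0 Q) (Matrix.fromBlocks R 0 0 S) =
      Matrix.fromBlocks (maxMul P R) 0 0 (maxMul Q S) := by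
  ext (i | i) (k | k)
  · apply le_antisymm
    · refine Real.iSup_le ?_ ((hP.maxMul hR) i k)
      rintro (j | j)
      · exact le_iSup_of_finite (fun j => P i j * R j k) j
      · simpa using (hP.maxMul hR) i k
    · refine Real.iSup_le (fun j => ?_)
        (((hP.fromBlocks hQ).maxMul (hR.fromBlocks hS)) (Sum.inl i) (Sum.inl k))
      exact le_iSup_of_finite (fun j => Matrix.fromBlocks P 0 0 Q (Sum.inl i) j *
        Matrix.fromBlocks R 0 0 S j (Sum.inl k)) (Sum.inl j)
  · have h : ∀ j, Matrix.fromBlocks P 0 0 Q (Sum.inl i) j *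
        Matrix.fromBlocks R 0 0 S j (Sum.inr k) = 0 := by
      rintro (j | j) <;> simp
    simp only [maxMul, Matrix.of_apply, h, Real.iSup_const_zero, Matrix.fromBlocks_apply₁₂,
      Matrix.zero_apply]
  · have h : ∀ j, Matrix.fromBlocks P 0 0 Q (Sum.inr i) j *
        Matrix.fromBlocks R 0 0 S j (Sum.inl k) = 0 := by
      rintro (j | j) <;> simp
    simp only [maxMul, Matrix.of_apply, h, Real.iSup_const_zero, Matrix.fromBlocks_apply₂₁,
      Matrix.zero_apply]
  · apply le_antisymm
    · refine Real.iSup_le ?_ ((hQ.maxMul hS) i k)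
      rintro (j | j)
      · simpa using (hQ.maxMul hS) i k
      · exact le_iSup_of_finite (fun j => Q i j * S j k) j
    · refine Real.iSup_le (fun j => ?_)
        (((hP.fromBlocks hQ).maxMul (hR.fromBlocks hS)) (Sum.inr i) (Sum.inr k))
      exact le_iSup_of_finite (fun j => Matrix.fromBlocks P 0 0 Q (Sum.inr i) j *
        Matrix.fromBlocks R 0 0 S j (Sum.inr k)) (Sum.inr j)

/-- The max numerical range of a nonnegative matrix is contained in `[0, ‖M‖]`. -/
lemma WMax_subset_Icc [Fintype I] {M : Matrix I I ℝ} (hM : Nonneg M) :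
    WMax M ⊆ Set.Icc 0 (matNorm M) := by
  rintro _ ⟨x, hx, hx1, rfl⟩
  have hx_le : ∀ i, x i 0 ≤ 1 := fun i => by
    have h : x i 0 * x i 0 ≤ maxMul xᵀ x 0 0 :=
      le_iSup_of_finite (fun i => x i 0 * x i 0) i
    rw [hx1, Matrix.one_apply_eq] at h
    nlinarith [hx i 0]
  refine ⟨Nonneg.maxMul (fun i j => hx j i) (hM.maxMul hx) 0 0,
    Real.iSup_le (fun i => ?_) (matNorm_nonneg M)⟩
  refine (mul_le_of_le_one_left (hM.maxMul hx i 0) (hx_le i)).trans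
    (Real.iSup_le (fun j => ?_) (matNorm_nonneg M))
  exact (mul_le_of_le_one_right (hM i j) (hx_le j)).trans
    ((le_abs_self _).trans (abs_le_matNorm M i j))

/-- A nonnegative matrix with a vanishing diagonal entry has max numerical range `[0, ‖M‖]`. -/
lemma WMax_eq_Icc [Fintype I] {M : Matrix I I ℝ} (hM : Nonneg M) {k : I} (hk : M k k = 0) :
    WMax M = Set.Icc 0 (matNorm M) := by
  classical
  refine (WMax_subset_Icc hM).antisymm ?_
  have : Nonempty I := ⟨k⟩
  let x : ℝ → Matrix I (Fin 1) ℝ := fun t => Matrix.of fun i _ => if i = k then 1 else t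
  have hx_cont : ∀ i, Continuous fun t => x t i 0 := fun i => by
    by_cases h : i = k
    · simpa [x, h] using continuous_const
    · simpa [x, h] using continuous_id'
  let f : ℝ → ℝ := fun t => ⨆ i, x t i 0 * ⨆ j, M i j * x t j 0
  have hf : Continuous f := continuous_iSup_of_finite fun i =>
    (hx_cont i).mul (continuous_iSup_of_finite fun j => continuous_const.mul (hx_cont j))
  have hf0 : f 0 = 0 := by
    have h : ∀ i, (x 0 i 0 * ⨆ j, M i j * x 0 j 0) = 0 := fun i => by
      by_cases hi : i = k
      · subst hi
        have h' : ∀ j, M i j * x 0 j 0 = 0 := fun j => by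
          by_cases hj : j = i
          · subst hj; simp [hk]
          · simp [x, hj]
        simp [h']
      · simp [x, hi]
    simp [f, h]
  have hf1 : f 1 = matNorm M := by
    simp [f, x, matNorm, abs_of_nonneg (hM _ _)]
  intro y hy
  rw [← hf0, ← hf1] at hy
  obtain ⟨t, ⟨ht0, ht1⟩, rfl⟩ := intermediate_value_Icc zero_le_one hf.continuousOn hy
  refine ⟨x t, fun i j => ?_, ?_, rfl⟩
  · simp only [x, Matrix.of_apply]
    split_ifs
    exacts [zero_le_one, ht0]
  · ext a b
    rw [Subsingleton.elim a 0, Subsingleton.elim b 0, Matrix.one_apply_eq]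
    apply le_antisymm
    · refine Real.iSup_le (fun i => ?_) zero_le_one
      simp only [x, Matrix.transpose_apply, Matrix.of_apply]
      split_ifs
      · simp
      · exact mul_le_one₀ ht1 ht0 ht1
    · simpa [x, maxMul] using le_iSup_of_finite (fun i => x t i 0 * x t i 0) k

/-- for `A = diag(I_r, A₁)` and `B = diag(C, B₁)`, if some `c_ii = 0`
and `‖A₁⊗B₁‖ = ‖B₁⊗A₁‖`, then
`W_max(A⊗B) = W_max(B⊗A) = [0, max(‖A₁⊗B₁‖, ‖C‖)]`. -/
theorem wmax_maxMul_blockDiag {r s : ℕ} (hs : 0 < s)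
    (A₁ B₁ : Matrix (Fin s) (Fin s) ℝ) (hA₁ : Nonneg A₁) (hB₁ : Nonneg B₁)
    (C : Matrix (Fin r) (Fin r) ℝ) (hC : Nonneg C) (hCi : ∃ i, C i i = 0)
    (hnorm : matNorm (maxMul A₁ B₁) = matNorm (maxMul B₁ A₁)) :
    WMax (maxMul (Matrix.fromBlocks (1 : Matrix (Fin r) (Fin r) ℝ) 0 0 A₁)
                 (Matrix.fromBlocks C 0 0 B₁)) =
      Set.Icc 0 (max (matNorm (maxMul A₁ B₁)) (matNorm C)) ∧
    WMax (maxMul (Matrix.fromBlocks C 0 0 B₁)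
                 (Matrix.fromBlocks (1 : Matrix (Fin r) (Fin r) ℝ) 0 0 A₁)) =
      Set.Icc 0 (max (matNorm (maxMul A₁ B₁)) (matNorm C)) := by
  obtain ⟨k, hk⟩ := hCi
  have hWMax : ∀ D : Matrix (Fin s) (Fin s) ℝ, Nonneg D →
      WMax (Matrix.fromBlocks C 0 0 D) = Set.Icc 0 (max (matNorm D) (matNorm C)) := by
    intro D hD
    rw [WMax_eq_Icc (hC.fromBlocks hD) (k := Sum.inl k) hk, matNorm_fromBlocks, max_comm]
  constructor
  · rw [maxMul_fromBlocks nonneg_one hA₁ hC hB₁, one_maxMul hC, hWMax _ (hA₁.maxMul hB₁)]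
  · rw [maxMul_fromBlocks hC hB₁ nonneg_one hA₁, maxMul_one hC, hWMax _ (hB₁.maxMul hA₁), hnorm]

end MaxAlg
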